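/- Suppose there exist d ∈ ℝ, a constant C₂ > 0, a strictly increasing sequence (α_l)_{l≥1} of positive reals with α_l ≤ C₂·l for all l ≥ 1, and a subset 𝔏 of the positive integers with Σ_{l∈𝔏} 1/l = ∞, such that a_{L3}(λ,α_l)/a_{L1}(λ,α_l) = e^{−id} · ã_{L3}(λ,α_l)/ã_{L1}(λ,α_l) for all l ∈ 𝔏 (the quotients are well defined since |a_{L1}(λ,z)| ≥ 1 and |ã_{L1}(λ,z)| ≥ 1 for real z). Then for all z ∈ ℂ: a_{L1}(λ,z) = ã_{L1}(λ,z), a_{L2}(λ,z) = e^{id}·ã_{L2}(λ,z), a_{L3}(λ,z) = e^{−id}·ã_{L3}(λ,z), and a_{L4}(λ,z) = ã_{L4}(λ,z). -/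

import Mathlib

open MeasureTheory Set Filter

noncomputable def mL1 (q : ℝ → ℂ) (lam : ℝ) : ℕ → ℝ → ℂ
  | 0, _ => 1
  | n + 1, x =>
      ∫ y in Ioi x, (∫ t in Ioi y,
        Complex.exp (2 * Complex.I * (lam : ℂ) * ((t : ℂ) - (y : ℂ))) * q y *
          (starRingEnd ℂ) (q t) * mL1 q lam n t)

noncomputable def mL2 (q : ℝ → ℂ) (lam : ℝ) : ℕ → ℝ → ℂ
  | 0, x =>
      -Complex.I * (∫ y in Ioi x,
        Complex.exp (-(2 * Complex.I * (lam : ℂ) * ((y : ℂ) - (x : ℂ)))) * q y)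
  | n + 1, x =>
      ∫ y in Ioi x, (∫ t in Ioi y,
        Complex.exp (-(2 * Complex.I * (lam : ℂ) * ((y : ℂ) - (x : ℂ)))) * q y *
          (starRingEnd ℂ) (q t) * mL2 q lam n t)

noncomputable def mL3 (q : ℝ → ℂ) (lam : ℝ) : ℕ → ℝ → ℂ
  | 0, x =>
      Complex.I * (∫ y in Ioi x,
        Complex.exp (2 * Complex.I * (lam : ℂ) * ((y : ℂ) - (x : ℂ))) * (starRingEnd ℂ) (q y))
  | n + 1, x =>
      ∫ y in Ioi x, (∫ t in Ioi y,
        Complex.exp (2 * Complex.I * (lam : ℂ) * ((y : ℂ) - (x : ℂ))) * (starRingEnd ℂ) (q y) *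
          q t * mL3 q lam n t)

noncomputable def mL4 (q : ℝ → ℂ) (lam : ℝ) : ℕ → ℝ → ℂ
  | 0, _ => 1
  | n + 1, x =>
      ∫ y in Ioi x, (∫ t in Ioi y,
        Complex.exp (-(2 * Complex.I * (lam : ℂ) * ((t : ℂ) - (y : ℂ)))) * (starRingEnd ℂ) (q y) *
          q t * mL4 q lam n t)

noncomputable def ML1 (q : ℝ → ℂ) (lam : ℝ) (x : ℝ) (z : ℂ) : ℂ :=
  ∑' n : ℕ, mL1 q lam n x * z ^ (2 * n)

noncomputable def ML2 (q : ℝ → ℂ) (lam : ℝ) (x : ℝ) (z : ℂ) : ℂ :=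
  ∑' n : ℕ, mL2 q lam n x * z ^ (2 * n + 1)

noncomputable def ML3 (q : ℝ → ℂ) (lam : ℝ) (x : ℝ) (z : ℂ) : ℂ :=
  ∑' n : ℕ, mL3 q lam n x * z ^ (2 * n + 1)

noncomputable def ML4 (q : ℝ → ℂ) (lam : ℝ) (x : ℝ) (z : ℂ) : ℂ :=
  ∑' n : ℕ, mL4 q lam n x * z ^ (2 * n)

noncomputable def aL1 (q : ℝ → ℂ) (lam : ℝ) (z : ℂ) : ℂ :=
  1 - Complex.I * z * (∫ x : ℝ, q x * ML3 q lam x z)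

noncomputable def aL2 (q : ℝ → ℂ) (lam : ℝ) (z : ℂ) : ℂ :=
  -Complex.I * z * (∫ x : ℝ, Complex.exp (-(2 * Complex.I * (lam : ℂ) * (x : ℂ))) * q x * ML4 q lam x z)

noncomputable def aL3 (q : ℝ → ℂ) (lam : ℝ) (z : ℂ) : ℂ :=
  Complex.I * z * (∫ x : ℝ, Complex.exp (2 * Complex.I * (lam : ℂ) * (x : ℂ)) * (starRingEnd ℂ) (q x) * ML1 q lam x z)

noncomputable def aL4 (q : ℝ → ℂ) (lam : ℝ) (z : ℂ) : ℂ :=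
  1 + Complex.I * z * (∫ x : ℝ, (starRingEnd ℂ) (q x) * ML2 q lam x z)


theorem xpl {f : ℂ → ℂ} (hf : Differentiable ℂ f) {K B R C : ℝ}
    (hexp : ∀ z : ℂ, 0 ≤ z.re → ‖f z‖ ≤ K * Real.exp (B * ‖z‖))
    (hre : ∀ x : ℝ, 0 ≤ x → ‖f x‖ ≤ R) (him : ∀ y : ℝ, ‖f (y * Complex.I)‖ ≤ C)
    {z : ℂ} (hz : 0 ≤ z.re) : ‖f z‖ ≤ C := by
  refine PhragmenLindelof.right_half_plane_of_bounded_on_real hf.diffContOnCl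
    ⟨1, by norm_num, B, ?_⟩ ?_ him hz
  · refine Asymptotics.IsBigO.of_bound K ?_
    refine eventually_inf_principal.2 (Eventually.of_forall fun w hw => ?_)
    have := hexp w (le_of_lt hw)
    simpa [Real.abs_exp] using this
  · exact ⟨R, eventually_map.2 ((eventually_ge_atTop 0).mono fun x hx => hre x hx)⟩

theorem xdiv {h : ℂ → ℂ} (hd : Differentiable ℂ h) {K M : ℝ}
    (hK : ∀ z : ℂ, 0 ≤ z.re → ‖h z‖ ≤ K) (him : ∀ y : ℝ, ‖h (y * Complex.I)‖ ≤ M)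
    {α : ℝ} (hα : 0 < α) (h0 : h α = 0) :
    ∃ h1 : ℂ → ℂ, Differentiable ℂ h1 ∧ (∃ K1, ∀ z : ℂ, 0 ≤ z.re → ‖h1 z‖ ≤ K1) ∧
      (∀ y : ℝ, ‖h1 (y * Complex.I)‖ ≤ M) ∧ ∀ z, h z * (z + α) = h1 z * (z - α) := by
  have key : ∀ z : ℂ, h z = dslope h α z * (z - α) := fun z => by
    have := sub_smul_dslope h (α : ℂ) z
    rw [smul_eq_mul, h0, sub_zero] at this
    rw [← this]; ring
  have hdd : Differentiable ℂ (dslope h (α : ℂ)) := by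
    rw [← differentiableOn_univ]
    exact (Complex.differentiableOn_dslope univ_mem).2 hd.differentiableOn
  have hd1 : Differentiable ℂ (fun z => dslope h (α : ℂ) z * (z + α)) := hdd.mul (by fun_prop)
  refine ⟨fun z => dslope h α z * (z + α), hd1, ?_, ?_, ?_⟩
  · obtain ⟨K2, hK2⟩ := (isCompact_closedBall (α : ℂ) 1).exists_bound_of_continuousOn
      hd1.continuous.continuousOn
    refine ⟨max K2 (K * (1 + 2 * α)), fun z hz => ?_⟩
    by_cases hzz : z ∈ Metric.closedBall (α : ℂ) 1
    · exact (hK2 z hzz).trans (le_max_left _ _)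
    · refine le_trans ?_ (le_max_right _ _)
      rw [Metric.mem_closedBall, not_le, dist_eq_norm] at hzz
      have h1 : ‖z + α‖ ≤ (1 + 2 * α) * ‖z - α‖ := by
        have : z + α = (z - α) + ((2 * α : ℝ) : ℂ) := by push_cast; ring
        rw [this]
        refine (norm_add_le _ _).trans ?_
        rw [Complex.norm_real, Real.norm_of_nonneg (by positivity)]
        nlinarith
      have h2 : ‖dslope h (α : ℂ) z‖ * ‖z - α‖ ≤ K := by
        rw [← norm_mul, ← key]; exact hK z hz
      calc ‖dslope h (α : ℂ) z * (z + α)‖ = ‖dslope h (α : ℂ) z‖ * ‖z + α‖ := norm_mul _ _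
        _ ≤ ‖dslope h (α : ℂ) z‖ * ((1 + 2 * α) * ‖z - α‖) := by gcongr
        _ = (‖dslope h (α : ℂ) z‖ * ‖z - α‖) * (1 + 2 * α) := by ring
        _ ≤ _ := by gcongr
  · intro y
    have h1 : ‖(y * Complex.I + α : ℂ)‖ = ‖(y * Complex.I - α : ℂ)‖ := by
      rw [Complex.norm_def, Complex.norm_def]; congr 1
      simp [Complex.normSq_apply]
    have := him y
    rw [key, norm_mul] at this
    simpa [h1] using this
  · intro z
    simp only
    rw [key z]; ring

theorem xblaschke (S : Finset ℝ) : ∀ {h : ℂ → ℂ} (_ : Differentiable ℂ h) {K M : ℝ}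
    (_ : ∀ z : ℂ, 0 ≤ z.re → ‖h z‖ ≤ K) (_ : ∀ y : ℝ, ‖h (y * Complex.I)‖ ≤ M)
    (_ : ∀ s ∈ S, 0 < s ∧ h (s : ℂ) = 0) (x : ℝ) (_ : 0 < x) (_ : ∀ s ∈ S, x < s),
    ‖h x‖ ≤ M * Real.exp (- x * ∑ s ∈ S, 1 / s) := by
  induction S using Finset.induction_on with
  | empty =>
    intro h hd K M hK him _ x hx _
    simp only [Finset.sum_empty, mul_zero, Real.exp_zero, mul_one]
    refine xpl hd (K := K) (B := 0) (R := K) (by simpa using hK) (fun x hx => hK x (by simpa using hx)) him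
      (by simpa using hx.le)
  | insert s S hs ih =>
    intro h hd K M hK him h0 x hx hxS
    obtain ⟨hs0, hhs⟩ := h0 s (by simp)
    obtain ⟨h1, hd1, ⟨K1, hK1⟩, him1, hh⟩ := xdiv hd hK him hs0 hhs
    have hxs := hxS s (by simp)
    have := ih hd1 hK1 him1 (fun t ht => ?_) x hx (fun t ht => hxS t (by simp [ht]))
    · have e := hh x
      have e2 : ‖h x‖ * (x + s) = ‖h1 x‖ * (s - x) := by
        have := congrArg norm e
        rw [norm_mul, norm_mul, ← Complex.ofReal_add, ← Complex.ofReal_sub, Complex.norm_real,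
          Complex.norm_real, Real.norm_of_nonneg (by positivity),
          Real.norm_of_nonpos (by linarith)] at this
        linarith
      rw [Finset.sum_insert hs]
      have hexp : (s - x) / (x + s) ≤ Real.exp (-x * (1 / s)) := by
        have : 1 + (-x * (1/s)) ≤ Real.exp (-x * (1 / s)) := by
          have := Real.add_one_le_exp (-x * (1/s)); linarith
        refine le_trans ?_ this
        rw [div_le_iff₀ (by positivity)]
        have : (1 + -x * (1 / s)) * (x + s) = s - x + x * (1 - x / s) := by field_simp; ring
        rw [this]
        have : x / s ≤ 1 := by rw [div_le_one hs0]; exact hxs.le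
        nlinarith
      have e3 : ‖h x‖ = ‖h1 x‖ * ((s - x) / (x + s)) := by
        field_simp; exact e2
      rw [e3, mul_add, Real.exp_add]
      calc ‖h1 x‖ * ((s - x) / (x + s)) ≤ (M * Real.exp (- x * ∑ s ∈ S, 1 / s)) * Real.exp (-x * (1 / s)) := by
            have : 0 ≤ (s - x) / (x + s) := div_nonneg (by linarith) (by positivity)
            gcongr
            exact (norm_nonneg _).trans (by assumption)
        _ = _ := by ring
    · obtain ⟨ht0, hht⟩ := h0 t (by simp [ht])
      refine ⟨ht0, ?_⟩
      have := hh t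
      rw [hht, zero_mul] at this
      rcases mul_eq_zero.1 this.symm with h | h
      · exact h
      · exfalso
        rw [sub_eq_zero] at h
        have : t = s := by exact_mod_cast h
        exact hs (this ▸ ht)

theorem xuniq {f : ℂ → ℂ} (hf : Differentiable ℂ f) {K B M : ℝ}
    (hexp : ∀ z : ℂ, ‖f z‖ ≤ K * Real.exp (B * ‖z‖)) (him : ∀ y : ℝ, ‖f (y * Complex.I)‖ ≤ M)
    {m : ℝ} (hm : 0 < m)
    (hS : ∀ R : ℝ, ∃ S : Finset ℝ, (∀ s ∈ S, m ≤ s ∧ f (s : ℂ) = 0) ∧ R ≤ ∑ s ∈ S, 1 / s) :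
    ∀ z, f z = 0 := by
  set h : ℂ → ℂ := fun z => f z * Complex.exp (-(B * z)) with hh
  have hd : Differentiable ℂ h := hf.mul (by fun_prop)
  have hhim : ∀ y : ℝ, ‖h (y * Complex.I)‖ ≤ M := fun y => by
    simp only [hh, norm_mul, Complex.norm_exp]
    simpa using him y
  have hK : ∀ z : ℂ, 0 ≤ z.re → ‖h z‖ ≤ M := fun z hz => by
    have hK0 : 0 ≤ K := by have := (norm_nonneg _).trans (hexp 0); simpa using this
    refine xpl hd (K := K) (B := B + |B|) (R := K) (fun w hw => ?_) (fun x hx => ?_) hhim hz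
    · simp only [hh, norm_mul, Complex.norm_exp]
      rw [add_mul, Real.exp_add, ← mul_assoc]
      gcongr
      · exact hexp w
      · have : |B * w.re| ≤ |B| * ‖w‖ := by
          rw [abs_mul]; gcongr; exact Complex.abs_re_le_norm w
        have := neg_abs_le (B * w.re)
        simp only [Complex.neg_re, Complex.re_ofReal_mul]
        linarith
    · simp only [hh, norm_mul, Complex.norm_exp]
      have := hexp x
      rw [Complex.norm_real, Real.norm_of_nonneg hx] at this
      calc _ ≤ K * Real.exp (B * x) * Real.exp (-(B * x)) := by
            simp only [Complex.neg_re, Complex.re_ofReal_mul, Complex.ofReal_re]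
            gcongr
        _ = K := by rw [mul_assoc, ← Real.exp_add]; simp
  have hzero : ∀ x : ℝ, 0 < x → x < m → h x = 0 := by
    intro x hx hxm
    have hM : 0 ≤ M := (norm_nonneg _).trans (hhim 0)
    have hle : ∀ R : ℝ, ‖h x‖ ≤ M * Real.exp (-x * R) := fun R => by
      obtain ⟨S, hS1, hS2⟩ := hS R
      refine (xblaschke S hd hK hhim (fun s hs => ⟨hm.trans_le (hS1 s hs).1, ?_⟩) x hx
        (fun s hs => hxm.trans_le (hS1 s hs).1)).trans ?_
      · simp [hh, (hS1 s hs).2]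
      · have : -x * ∑ s ∈ S, 1 / s ≤ -x * R := by nlinarith
        gcongr
    have ht : Tendsto (fun R : ℝ => M * Real.exp (-x * R)) atTop (nhds (M * 0)) := by
      refine Tendsto.const_mul _ (Real.tendsto_exp_atBot.comp ?_)
      exact tendsto_id.const_mul_atTop_of_neg (by linarith)
    have := ge_of_tendsto' ht hle
    rw [mul_zero] at this
    exact norm_le_zero_iff.1 this
  have hfz : ∀ x : ℝ, 0 < x → x < m → f x = 0 := fun x h1 h2 => by
    have := hzero x h1 h2
    simp only [hh] at this
    rcases mul_eq_zero.1 this with h | h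
    · exact h
    · exact absurd h (Complex.exp_ne_zero _)
  have hana : AnalyticOnNhd ℂ f univ := fun z _ => hf.analyticAt z
  have := hana.eqOn_zero_of_preconnected_of_frequently_eq_zero isPreconnected_univ
    (z₀ := ((m / 2 : ℝ) : ℂ)) (mem_univ _) ?_
  · exact fun z => this (mem_univ z)
  · have ht : Tendsto (fun x : ℝ => (x : ℂ)) (nhdsWithin (m / 2) {m/2}ᶜ)
        (nhdsWithin ((m / 2 : ℝ) : ℂ) {((m / 2 : ℝ) : ℂ)}ᶜ) := by
      refine tendsto_nhdsWithin_iff.2 ⟨?_, ?_⟩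
      · exact (Complex.continuous_ofReal.tendsto _).mono_left nhdsWithin_le_nhds
      · filter_upwards [self_mem_nhdsWithin] with x hx
        intro h
        exact hx (Complex.ofReal_injective h)
    refine ht.frequently (Eventually.frequently ?_)
    have : Ioo 0 m ∈ nhds (m / 2) := Ioo_mem_nhds (by linarith) (by linarith)
    filter_upwards [mem_nhdsWithin_of_mem_nhds this] with x hx
    exact hfz x hx.1 hx.2

theorem xliou {g : ℂ → ℂ} (hg : Differentiable ℂ g) {K B : ℝ}
    (hexp : ∀ z : ℂ, ‖g z‖ ≤ K * Real.exp (B * ‖z‖))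
    (hre : ∀ x : ℝ, ‖g x‖ ≤ 1) (him : ∀ y : ℝ, ‖g (y * Complex.I)‖ ≤ 1) (z : ℂ) : g z = g 0 := by
  refine hg.apply_eq_apply_of_bounded ?_ z 0
  refine isBounded_iff_forall_norm_le.2 ⟨1, ?_⟩
  rintro _ ⟨w, rfl⟩
  rcases le_total 0 w.re with h | h
  · exact xpl hg (fun z _ => hexp z) (fun x _ => hre x) him h
  · have := xpl (f := fun z => g (-z)) (hg.comp differentiable_neg) (K := K) (B := B) (R := 1) (C := 1)
      (fun z _ => by simpa using hexp (-z)) (fun x _ => by simpa using hre (-x))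
      (fun y => by simpa using him (-y)) (z := -w) (by simpa using h)
    simpa using this

section tails

theorem ytail_deriv {E : Type*} [NormedAddCommGroup E] [NormedSpace ℝ E] [CompleteSpace E]
    {g : ℝ → E} (hg : Continuous g) (hi : Integrable g) (x : ℝ) :
    HasDerivAt (fun x => ∫ y in Ioi x, g y) (-g x) x := by
  have : (fun x => ∫ y in Ioi x, g y) = fun x => (∫ y in Ioi 0, g y) - ∫ y in (0:ℝ)..x, g y := by
    funext x
    rw [← intervalIntegral.integral_Ioi_sub_Ioi' hi.integrableOn hi.integrableOn]
    abel
  rw [this]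
  have h := intervalIntegral.integral_hasDerivAt_right (hg.intervalIntegrable 0 x)
    (hg.stronglyMeasurableAtFilter _ _) hg.continuousAt
  exact h.const_sub _

theorem ytail_top {E : Type*} [NormedAddCommGroup E] [NormedSpace ℝ E] [CompleteSpace E]
    (g : ℝ → E) :
    Tendsto (fun x => ∫ y in Ioi x, g y) atTop (nhds 0) := tendsto_integral_Ioi_zero tendsto_id

theorem ytail_bot {E : Type*} [NormedAddCommGroup E] [NormedSpace ℝ E] [CompleteSpace E]
    {g : ℝ → E} (hi : Integrable g) :
    Tendsto (fun x => ∫ y in Ioi x, g y) atBot (nhds (∫ y, g y)) :=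
  (aecover_Ioi tendsto_id).integral_tendsto_of_countably_generated hi

end tails

noncomputable def ww (q : ℝ → ℂ) (lam : ℝ) (k : ℕ) (y : ℝ) : ℂ :=
  if Even k then Complex.I * Complex.exp (2 * Complex.I * (lam : ℂ) * (y : ℂ)) * (starRingEnd ℂ) (q y)
  else -Complex.I * Complex.exp (-(2 * Complex.I * (lam : ℂ) * (y : ℂ))) * q y

noncomputable def uu (q : ℝ → ℂ) (lam : ℝ) : ℕ → ℝ → ℂ
  | 0, _ => 1
  | k + 1, x => ∫ y in Ioi x, ww q lam k y * uu q lam k y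

noncomputable def cc (q : ℝ → ℂ) (lam : ℝ) : ℕ → ℂ
  | 0 => 1
  | k + 1 => ∫ y, ww q lam k y * uu q lam k y

theorem ww_even (q : ℝ → ℂ) (lam : ℝ) (n : ℕ) (y : ℝ) : ww q lam (2 * n) y = ww q lam 0 y := by
  simp [ww]

theorem ww_odd (q : ℝ → ℂ) (lam : ℝ) (n : ℕ) (y : ℝ) : ww q lam (2 * n + 1) y = ww q lam 1 y := by
  simp [ww]

theorem ww_conj0 (q : ℝ → ℂ) (lam : ℝ) (y : ℝ) :
    (starRingEnd ℂ) (ww q lam 0 y) = ww q lam 1 y := by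
  simp [ww, ← Complex.exp_conj, Complex.conj_ofNat]

theorem ww_conj1 (q : ℝ → ℂ) (lam : ℝ) (y : ℝ) :
    (starRingEnd ℂ) (ww q lam 1 y) = ww q lam 0 y := by
  rw [← ww_conj0, Complex.conj_conj]

theorem ww_norm (q : ℝ → ℂ) (lam : ℝ) (k : ℕ) (y : ℝ) : ‖ww q lam k y‖ = ‖q y‖ := by
  unfold ww
  split_ifs <;> simp [Complex.norm_exp]

theorem ww_cont {q : ℝ → ℂ} (hq : Continuous q) (lam : ℝ) (k : ℕ) : Continuous (ww q lam k) := by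
  unfold ww
  split_ifs
  · exact Continuous.mul (by fun_prop) (Complex.continuous_conj.comp hq)
  · fun_prop

theorem ww_int {q : ℝ → ℂ} (hq : Continuous q) (hi : Integrable q) (lam : ℝ) (k : ℕ) :
    Integrable (ww q lam k) :=
  hi.mono (ww_cont hq lam k).aestronglyMeasurable
    (Eventually.of_forall fun y => (ww_norm q lam k y).le)

noncomputable def tt (q : ℝ → ℂ) (x : ℝ) : ℝ := ∫ y in Ioi x, ‖q y‖

theorem tt_nonneg (q : ℝ → ℂ) (x : ℝ) : 0 ≤ tt q x := integral_nonneg fun _ => norm_nonneg _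

theorem tt_le {q : ℝ → ℂ} (hi : Integrable q) (x : ℝ) : tt q x ≤ ∫ y, ‖q y‖ :=
  setIntegral_le_integral hi.norm (Eventually.of_forall fun _ => norm_nonneg _)

theorem tt_int {q : ℝ → ℂ} (hq : Continuous q) (hi : Integrable q) (k : ℕ) :
    Integrable (fun y => ‖q y‖ * (tt q y ^ k / k.factorial)) := by
  refine hi.norm.mul_bdd (c := (∫ y, ‖q y‖) ^ k / k.factorial) ?_ (Eventually.of_forall fun y => ?_)
  · have : Continuous (tt q) := continuous_iff_continuousAt.2 fun x =>
      (ytail_deriv hq.norm hi.norm x).continuousAt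
    exact (by fun_prop : Continuous fun y => tt q y ^ k / k.factorial).aestronglyMeasurable
  · have := tt_nonneg q y
    rw [Real.norm_of_nonneg (by positivity)]
    have := tt_le hi y
    gcongr

theorem tt_step {q : ℝ → ℂ} (hq : Continuous q) (hi : Integrable q) (k : ℕ) (x : ℝ) :
    ∫ y in Ioi x, ‖q y‖ * (tt q y ^ k / k.factorial) = tt q x ^ (k + 1) / (k + 1).factorial := by
  have hder : ∀ y ∈ Ici x, HasDerivAt (fun y => - (tt q y ^ (k + 1) / (k + 1).factorial))
      (‖q y‖ * (tt q y ^ k / k.factorial)) y := fun y _ => by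
    have h := (((ytail_deriv hq.norm hi.norm y).pow (k + 1)).div_const ((k + 1).factorial : ℝ)).neg
    refine h.congr_deriv ?_
    have : (k.factorial : ℝ) ≠ 0 := by positivity
    simp only [Nat.factorial_succ, tt]
    push_cast
    field_simp
  have hlim : Tendsto (fun y => - (tt q y ^ (k + 1) / (k + 1).factorial)) atTop (nhds 0) := by
    have := ((((ytail_top fun y => ‖q y‖)).pow (k + 1)).div_const ((k + 1).factorial : ℝ)).neg
    simpa [tt] using this
  rw [integral_Ioi_of_hasDerivAt_of_tendsto' hder (tt_int hq hi k).integrableOn hlim]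
  ring

theorem uu_prop {q : ℝ → ℂ} (hq : Continuous q) (hi : Integrable q) (lam : ℝ) (k : ℕ) :
    Continuous (uu q lam k) ∧ (∀ x, ‖uu q lam k x‖ ≤ tt q x ^ k / k.factorial) ∧
      Integrable (fun y => ww q lam k y * uu q lam k y) := by
  have main : ∀ k, (Continuous (uu q lam k) ∧ (∀ x, ‖uu q lam k x‖ ≤ tt q x ^ k / k.factorial)) →
      Integrable (fun y => ww q lam k y * uu q lam k y) := fun k h => by
    refine (tt_int hq hi k).mono' ((ww_cont hq lam k).mul h.1).aestronglyMeasurable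
      (Eventually.of_forall fun y => ?_)
    rw [norm_mul, ww_norm]
    have := h.2 y
    gcongr
  suffices h : Continuous (uu q lam k) ∧ (∀ x, ‖uu q lam k x‖ ≤ tt q x ^ k / k.factorial) from
    ⟨h.1, h.2, main k h⟩
  induction k with
  | zero => exact ⟨continuous_const, fun x => by simp [uu]⟩
  | succ k ih =>
    have hint := main k ih
    refine ⟨?_, fun x => ?_⟩
    · exact continuous_iff_continuousAt.2 fun x =>
        (ytail_deriv ((ww_cont hq lam k).mul ih.1) hint x).continuousAt
    · rw [← tt_step hq hi]
      refine norm_integral_le_of_norm_le (tt_int hq hi k).integrableOn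
        (Eventually.of_forall fun y => ?_)
      rw [norm_mul, ww_norm]
      have := ih.2 y
      gcongr

theorem uu_le {q : ℝ → ℂ} (hq : Continuous q) (hi : Integrable q) (lam : ℝ) (k : ℕ) (x : ℝ) :
    ‖uu q lam k x‖ ≤ (∫ y, ‖q y‖) ^ k / k.factorial := by
  refine ((uu_prop hq hi lam k).2.1 x).trans ?_
  have := tt_nonneg q x
  have := tt_le hi x
  gcongr

theorem cc_le {q : ℝ → ℂ} (hq : Continuous q) (hi : Integrable q) (lam : ℝ) (k : ℕ) :
    ‖cc q lam k‖ ≤ (∫ y, ‖q y‖) ^ k / k.factorial := by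
  have : Tendsto (uu q lam k) atBot (nhds (cc q lam k)) := by
    cases k with
    | zero => exact tendsto_const_nhds
    | succ k => exact ytail_bot (uu_prop hq hi lam k).2.2
  exact le_of_tendsto' this.norm (uu_le hq hi lam k)

theorem mL1_eq (q : ℝ → ℂ) (lam : ℝ) (n : ℕ) (x : ℝ) : mL1 q lam n x = uu q lam (2 * n) x := by
  induction n generalizing x with
  | zero => rfl
  | succ n ih =>
    change _ = uu q lam (2 * n + 1 + 1) x
    simp only [uu, mL1]
    refine integral_congr_ae (Eventually.of_forall fun y => ?_)
    simp only
    rw [← integral_const_mul]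
    refine integral_congr_ae (Eventually.of_forall fun t => ?_)
    simp only
    rw [ih, ww_even, ww_odd, mul_sub, sub_eq_add_neg, Complex.exp_add]
    simp only [ww, Even.zero, if_true, Nat.not_even_one, if_false]
    linear_combination
      (Complex.exp (2 * Complex.I * lam * t) * Complex.exp (-(2 * Complex.I * lam * y))
      * q y * (starRingEnd ℂ) (q t) * uu q lam (2 * n) t) * Complex.I_sq

theorem mL3_eq (q : ℝ → ℂ) (lam : ℝ) (n : ℕ) (x : ℝ) :
    mL3 q lam n x = Complex.exp (-(2 * Complex.I * lam * x)) * uu q lam (2 * n + 1) x := by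
  induction n generalizing x with
  | zero =>
    simp only [uu, mL3]
    rw [← integral_const_mul, ← integral_const_mul]
    refine integral_congr_ae (Eventually.of_forall fun y => ?_)
    simp only
    rw [mul_sub, sub_eq_add_neg, Complex.exp_add]
    simp only [ww, Even.zero, if_true, mul_zero]
    ring
  | succ n ih =>
    have e1 : uu q lam (2 * (n + 1) + 1) x = ∫ y in Ioi x, ww q lam (2 * n + 1 + 1) y *
      ∫ t in Ioi y, ww q lam (2 * n + 1) t * uu q lam (2 * n + 1) t := rfl
    rw [e1, mL3]
    rw [← integral_const_mul]
    refine integral_congr_ae (Eventually.of_forall fun y => ?_)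
    simp only
    rw [← integral_const_mul, ← integral_const_mul]
    refine integral_congr_ae (Eventually.of_forall fun t => ?_)
    simp only
    rw [ih, show 2 * n + 1 + 1 = 2 * (n + 1) by ring, ww_even, ww_odd, mul_sub, sub_eq_add_neg,
      Complex.exp_add]
    simp only [ww, Even.zero, if_true, Nat.not_even_one, if_false]
    linear_combination 
      (Complex.exp (2 * Complex.I * lam * y) * Complex.exp (-(2 * Complex.I * lam * x))
      * Complex.exp (-(2 * Complex.I * lam * t))
      * q t * (starRingEnd ℂ) (q y) * uu q lam (2 * n + 1) t) * Complex.I_sq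

theorem mL4_eq (q : ℝ → ℂ) (lam : ℝ) (n : ℕ) (x : ℝ) :
    mL4 q lam n x = (starRingEnd ℂ) (mL1 q lam n x) := by
  induction n generalizing x with
  | zero => simp [mL4, mL1]
  | succ n ih =>
    simp only [mL4, mL1]
    rw [← integral_conj]
    refine integral_congr_ae (Eventually.of_forall fun y => ?_)
    simp only
    rw [← integral_conj]
    refine integral_congr_ae (Eventually.of_forall fun t => ?_)
    simp [ih, ← Complex.exp_conj, Complex.conj_ofNat]

theorem mL2_eq (q : ℝ → ℂ) (lam : ℝ) (n : ℕ) (x : ℝ) :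
    mL2 q lam n x = (starRingEnd ℂ) (mL3 q lam n x) := by
  induction n generalizing x with
  | zero =>
    simp only [mL2, mL3]
    rw [map_mul, ← integral_conj, Complex.conj_I]
    congr 1
    refine integral_congr_ae (Eventually.of_forall fun y => ?_)
    simp [← Complex.exp_conj, Complex.conj_ofNat]
  | succ n ih =>
    simp only [mL2, mL3]
    rw [← integral_conj]
    refine integral_congr_ae (Eventually.of_forall fun y => ?_)
    simp only
    rw [← integral_conj]
    refine integral_congr_ae (Eventually.of_forall fun t => ?_)
    simp [ih, ← Complex.exp_conj, Complex.conj_ofNat]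

theorem aL4_eq (q : ℝ → ℂ) (lam : ℝ) (z : ℂ) :
    aL4 q lam z = (starRingEnd ℂ) (aL1 q lam ((starRingEnd ℂ) z)) := by
  simp only [aL4, aL1, ML2, ML3, map_sub, map_mul, ← integral_conj, Complex.conj_tsum, mL2_eq, map_pow,
    Complex.conj_conj, Complex.conj_I, map_one]
  ring

theorem aL2_eq (q : ℝ → ℂ) (lam : ℝ) (z : ℂ) :
    aL2 q lam z = (starRingEnd ℂ) (aL3 q lam ((starRingEnd ℂ) z)) := by
  simp only [aL2, aL3, ML1, ML4, map_mul, ← integral_conj, Complex.conj_tsum, mL4_eq, map_pow,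
    Complex.conj_conj, Complex.conj_I, ← Complex.exp_conj, Complex.conj_ofNat, Complex.conj_ofReal]
  simp

noncomputable def FF (q : ℝ → ℂ) (lam : ℝ) (z : ℂ) (x : ℝ) : ℂ :=
  ∑' n : ℕ, uu q lam (2 * n) x * z ^ (2 * n)

noncomputable def PP (q : ℝ → ℂ) (lam : ℝ) (z : ℂ) (x : ℝ) : ℂ :=
  ∑' n : ℕ, uu q lam (2 * n + 1) x * z ^ (2 * n + 1)

theorem aL1_eq (q : ℝ → ℂ) (lam : ℝ) (z : ℂ) :
    aL1 q lam z = 1 + z * ∫ x, ww q lam 1 x * PP q lam z x := by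
  have h : ∀ x, q x * ML3 q lam x z = Complex.I * (ww q lam 1 x * PP q lam z x) := fun x => by
    have e : ML3 q lam x z = Complex.exp (-(2 * Complex.I * lam * x)) * PP q lam z x := by
      simp only [ML3, PP, mL3_eq, ← tsum_mul_left]
      congr 1; funext n; ring
    rw [e]
    simp only [ww, Nat.not_even_one, if_false]
    linear_combination (Complex.exp (-(2 * Complex.I * lam * x)) * q x * PP q lam z x) * Complex.I_sq
  rw [aL1]
  simp_rw [h]
  rw [integral_const_mul]
  linear_combination (-z * ∫ x, ww q lam 1 x * PP q lam z x) * Complex.I_sq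

theorem aL3_eq (q : ℝ → ℂ) (lam : ℝ) (z : ℂ) :
    aL3 q lam z = z * ∫ x, ww q lam 0 x * FF q lam z x := by
  rw [aL3, mul_comm Complex.I z, mul_assoc, ← integral_const_mul]
  congr 1
  refine integral_congr_ae (Eventually.of_forall fun x => ?_)
  simp only [ML1, FF, mL1_eq, ww, Even.zero, if_true]
  ring

theorem zser {A r : ℝ} (hA : 0 ≤ A) (hr : 0 ≤ r) {φ : ℕ → ℕ} (hφ : Function.Injective φ) :
    Summable (fun n => A ^ φ n / (φ n).factorial * r ^ φ n) ∧
      ∑' n, A ^ φ n / (φ n).factorial * r ^ φ n ≤ Real.exp (A * r) := by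
  have e : ∀ n : ℕ, A ^ n / n.factorial * r ^ n = (A * r) ^ n / n.factorial := fun n => by
    rw [mul_pow]; ring
  simp_rw [e]
  have hs := Real.summable_pow_div_factorial (A * r)
  refine ⟨hs.comp_injective hφ, ?_⟩
  refine (tsum_comp_le_tsum_of_inj hs (fun n => by positivity) hφ).trans ?_
  rw [Real.exp_eq_exp_ℝ, NormedSpace.exp_eq_tsum_div]

theorem zsummable {A : ℝ} (hA : 0 ≤ A) {d : ℕ → ℂ} (hd : ∀ k, ‖d k‖ ≤ A ^ k / k.factorial)
    {φ : ℕ → ℕ} (hφ : Function.Injective φ) (z : ℂ) :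
    Summable (fun n => d (φ n) * z ^ φ n) :=
  Summable.of_norm_bounded (zser hA (norm_nonneg z) hφ).1 fun n => by
    rw [norm_mul, norm_pow]
    have := hd (φ n)
    gcongr

theorem zbound {A : ℝ} (hA : 0 ≤ A) {d : ℕ → ℂ} (hd : ∀ k, ‖d k‖ ≤ A ^ k / k.factorial)
    {φ : ℕ → ℕ} (hφ : Function.Injective φ) (z : ℂ) :
    ‖∑' n, d (φ n) * z ^ φ n‖ ≤ Real.exp (A * ‖z‖) := by
  refine (tsum_of_norm_bounded (zser hA (norm_nonneg z) hφ).1.hasSum fun n => ?_).trans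
    (zser hA (norm_nonneg z) hφ).2
  rw [norm_mul, norm_pow]
  have := hd (φ n)
  gcongr

theorem zdiff {A : ℝ} (hA : 0 ≤ A) {d : ℕ → ℂ} (hd : ∀ k, ‖d k‖ ≤ A ^ k / k.factorial)
    {φ : ℕ → ℕ} (hφ : Function.Injective φ) :
    Differentiable ℂ (fun z : ℂ => ∑' n, d (φ n) * z ^ φ n) := by
  intro z
  have hr : 0 ≤ ‖z‖ + 1 := by positivity
  have h := Complex.differentiableOn_tsum_of_summable_norm
    (F := fun n (z : ℂ) => d (φ n) * z ^ φ n) (U := Metric.ball 0 (‖z‖ + 1))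
    (zser hA hr hφ).1 (fun n => by fun_prop) Metric.isOpen_ball (fun n w hw => by
      rw [norm_mul, norm_pow]
      have := hd (φ n)
      have : ‖w‖ ≤ ‖z‖ + 1 := by
        have := mem_ball_zero_iff.1 hw
        exact this.le
      gcongr)
  exact (h z (by simp)).differentiableAt (Metric.isOpen_ball.mem_nhds (by simp))

theorem inj_even : Function.Injective (fun n : ℕ => 2 * n) := fun a b h => by simpa using h
theorem inj_odd : Function.Injective (fun n : ℕ => 2 * n + 1) := fun a b h => by simpa using h

theorem int_nn (q : ℝ → ℂ) : 0 ≤ ∫ y, ‖q y‖ := integral_nonneg fun _ => norm_nonneg _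

theorem ycont {q : ℝ → ℂ} (hq : Continuous q) (hi : Integrable q) (lam : ℝ) (z : ℂ)
    {φ : ℕ → ℕ} (hφ : Function.Injective φ) :
    Continuous (fun x => ∑' n, uu q lam (φ n) x * z ^ φ n) := by
  refine continuous_tsum (fun n => ((uu_prop hq hi lam (φ n)).1.mul continuous_const))
    (zser (int_nn q) (norm_nonneg z) hφ).1 (fun n x => ?_)
  rw [norm_mul, norm_pow]
  have := uu_le hq hi lam (φ n) x
  gcongr

theorem yint {q : ℝ → ℂ} (hq : Continuous q) (hi : Integrable q) (lam : ℝ) (z : ℂ) (k : ℕ)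
    {φ : ℕ → ℕ} (hφ : Function.Injective φ) :
    Integrable (fun x => ww q lam k x * ∑' n, uu q lam (φ n) x * z ^ φ n) :=
  (ww_int hq hi lam k).mul_bdd (ycont hq hi lam z hφ).aestronglyMeasurable
    (Eventually.of_forall fun x => zbound (int_nn q) (d := fun k => uu q lam k x)
      (fun k => uu_le hq hi lam k x) hφ z)

theorem yswap {q : ℝ → ℂ} (hq : Continuous q) (hi : Integrable q) (lam : ℝ) (z : ℂ) (k : ℕ)
    {φ : ℕ → ℕ} (hφ : Function.Injective φ) (s : Set ℝ) :
    ∫ x in s, ww q lam k x * ∑' n, uu q lam (φ n) x * z ^ φ n =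
      ∑' n, (∫ x in s, ww q lam k x * uu q lam (φ n) x) * z ^ φ n := by
  have hint : ∀ n, Integrable (fun x => ww q lam k x * (uu q lam (φ n) x * z ^ φ n)) := fun n => by
    refine (ww_int hq hi lam k).mul_bdd
      (((uu_prop hq hi lam (φ n)).1.mul continuous_const)).aestronglyMeasurable
      (c := (∫ y, ‖q y‖) ^ φ n / (φ n).factorial * ‖z‖ ^ φ n) (Eventually.of_forall fun x => ?_)
    rw [norm_mul, norm_pow]
    have := uu_le hq hi lam (φ n) x
    gcongr
  simp_rw [← tsum_mul_left]
  rw [← integral_tsum_of_summable_integral_norm (fun n => (hint n).integrableOn)]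
  · congr 1; funext n
    rw [← integral_mul_const]
    simp_rw [mul_assoc]
  · refine Summable.of_nonneg_of_le (fun n => integral_nonneg fun _ => norm_nonneg _) (fun n => ?_)
      ((zser (int_nn q) (norm_nonneg z) hφ).1.mul_left (∫ y, ‖q y‖))
    refine (setIntegral_le_integral (hint n).norm (Eventually.of_forall fun _ => norm_nonneg _)).trans ?_
    rw [← integral_mul_const]
    refine integral_mono (hint n).norm (hi.norm.mul_const _) fun x => ?_
    simp only
    rw [norm_mul, norm_mul, norm_pow, ww_norm]
    have := uu_le hq hi lam (φ n) x
    gcongr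

theorem ysum {q : ℝ → ℂ} (hq : Continuous q) (hi : Integrable q) (lam : ℝ) (z : ℂ) (s : Set ℝ)
    (d : ℕ → ℂ) (h0 : d 0 = 1) (h1 : ∀ k, d (k + 1) = ∫ y in s, ww q lam k y * uu q lam k y)
    (hd : ∀ k, ‖d k‖ ≤ (∫ y, ‖q y‖) ^ k / k.factorial) :
    ∑' n : ℕ, d (2 * n) * z ^ (2 * n) = 1 + z * ∫ x in s, ww q lam 1 x * PP q lam z x ∧
    ∑' n : ℕ, d (2 * n + 1) * z ^ (2 * n + 1) = z * ∫ x in s, ww q lam 0 x * FF q lam z x := by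
  constructor
  · rw [(zsummable (int_nn q) hd inj_even z).tsum_eq_zero_add]
    simp only [PP]
    rw [yswap hq hi lam z 1 inj_odd s, ← tsum_mul_left]
    simp only [mul_zero, h0, pow_zero, mul_one]
    congr 2; funext n
    rw [show 2 * (n + 1) = 2 * n + 1 + 1 by ring, h1, pow_succ]
    simp_rw [ww_odd]
    ring
  · simp only [FF]
    rw [yswap hq hi lam z 0 inj_even s, ← tsum_mul_left]
    congr 1; funext n
    rw [h1, pow_succ]
    simp_rw [ww_even]
    ring

theorem FF_eq {q : ℝ → ℂ} (hq : Continuous q) (hi : Integrable q) (lam : ℝ) (z : ℂ) (x : ℝ) :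
    FF q lam z x = 1 + z * ∫ x in Ioi x, ww q lam 1 x * PP q lam z x :=
  (ysum hq hi lam z (Ioi x) (fun k => uu q lam k x) rfl (fun _ => rfl)
    (fun k => uu_le hq hi lam k x)).1

theorem PP_eq {q : ℝ → ℂ} (hq : Continuous q) (hi : Integrable q) (lam : ℝ) (z : ℂ) (x : ℝ) :
    PP q lam z x = z * ∫ x in Ioi x, ww q lam 0 x * FF q lam z x :=
  (ysum hq hi lam z (Ioi x) (fun k => uu q lam k x) rfl (fun _ => rfl)
    (fun k => uu_le hq hi lam k x)).2

theorem aL1_ser {q : ℝ → ℂ} (hq : Continuous q) (hi : Integrable q) (lam : ℝ) (z : ℂ) :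
    aL1 q lam z = ∑' n : ℕ, cc q lam (2 * n) * z ^ (2 * n) := by
  rw [aL1_eq, (ysum hq hi lam z univ (cc q lam) rfl (fun _ => by simp [cc]) (cc_le hq hi lam)).1,
    setIntegral_univ]

theorem aL3_ser {q : ℝ → ℂ} (hq : Continuous q) (hi : Integrable q) (lam : ℝ) (z : ℂ) :
    aL3 q lam z = ∑' n : ℕ, cc q lam (2 * n + 1) * z ^ (2 * n + 1) := by
  rw [aL3_eq, (ysum hq hi lam z univ (cc q lam) rfl (fun _ => by simp [cc]) (cc_le hq hi lam)).2,
    setIntegral_univ]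

theorem FP {q : ℝ → ℂ} (hq : Continuous q) (hi : Integrable q) (lam : ℝ) (z : ℂ) :
    (∀ x, HasDerivAt (FF q lam z) (-z * (ww q lam 1 x * PP q lam z x)) x) ∧
    (∀ x, HasDerivAt (PP q lam z) (-z * (ww q lam 0 x * FF q lam z x)) x) ∧
    Tendsto (FF q lam z) atTop (nhds 1) ∧ Tendsto (PP q lam z) atTop (nhds 0) ∧
    Tendsto (FF q lam z) atBot (nhds (aL1 q lam z)) ∧
    Tendsto (PP q lam z) atBot (nhds (aL3 q lam z)) := by
  have hF : FF q lam z = fun x => 1 + z * ∫ x in Ioi x, ww q lam 1 x * PP q lam z x :=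
    funext fun x => FF_eq hq hi lam z x
  have hP : PP q lam z = fun x => z * ∫ x in Ioi x, ww q lam 0 x * FF q lam z x :=
    funext fun x => PP_eq hq hi lam z x
  have cF : Continuous fun x => ww q lam 0 x * FF q lam z x :=
    (ww_cont hq lam 0).mul (ycont hq hi lam z inj_even)
  have cP : Continuous fun x => ww q lam 1 x * PP q lam z x :=
    (ww_cont hq lam 1).mul (ycont hq hi lam z inj_odd)
  have iF : Integrable fun x => ww q lam 0 x * FF q lam z x := yint hq hi lam z 0 inj_even
  have iP : Integrable fun x => ww q lam 1 x * PP q lam z x := yint hq hi lam z 1 inj_odd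
  refine ⟨fun x => ?_, fun x => ?_, ?_, ?_, ?_, ?_⟩
  · have := ((ytail_deriv cP iP x).const_mul z).const_add 1
    rw [← hF] at this
    exact this.congr_deriv (by ring)
  · have := ((ytail_deriv cF iF x).const_mul z)
    rw [← hP] at this
    exact this.congr_deriv (by ring)
  · have := ((ytail_top fun x => ww q lam 1 x * PP q lam z x).const_mul z).const_add 1
    rw [← hF] at this
    simpa using this
  · have := ((ytail_top fun x => ww q lam 0 x * FF q lam z x).const_mul z)
    rw [← hP] at this
    simpa using this
  · have := ((ytail_bot iP).const_mul z).const_add 1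
    rw [← hF, ← aL1_eq] at this
    exact this
  · have := ((ytail_bot iF).const_mul z)
    rw [← hP, ← aL3_eq] at this
    exact this

theorem ydet {q : ℝ → ℂ} (hq : Continuous q) (hi : Integrable q) (lam : ℝ) (z : ℂ) :
    aL1 q lam z * (starRingEnd ℂ) (aL1 q lam ((starRingEnd ℂ) z)) -
      aL3 q lam z * (starRingEnd ℂ) (aL3 q lam ((starRingEnd ℂ) z)) = 1 := by
  obtain ⟨dF, dP, tF, tP, bF, bP⟩ := FP hq hi lam z
  obtain ⟨dF', dP', tF', tP', bF', bP'⟩ := FP hq hi lam ((starRingEnd ℂ) z)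
  set D : ℝ → ℂ := fun x => FF q lam z x * (starRingEnd ℂ) (FF q lam ((starRingEnd ℂ) z) x) -
    PP q lam z x * (starRingEnd ℂ) (PP q lam ((starRingEnd ℂ) z) x) with hD
  have hder : ∀ x, HasDerivAt D 0 x := fun x => by
    have h1 : HasDerivAt (fun x => (starRingEnd ℂ) (FF q lam ((starRingEnd ℂ) z) x)) _ x :=
      (dF' x).star
    have h2 : HasDerivAt (fun x => (starRingEnd ℂ) (PP q lam ((starRingEnd ℂ) z) x)) _ x :=
      (dP' x).star
    have := ((dF x).mul h1).sub ((dP x).mul h2)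
    refine this.congr_deriv ?_
    simp only [← starRingEnd_apply, map_mul, map_neg, Complex.conj_conj, ww_conj0, ww_conj1]
    ring
  have hconst : ∀ x, D x = D 0 := fun x =>
    is_const_of_deriv_eq_zero (fun y => (hder y).differentiableAt) (fun y => (hder y).deriv) x 0
  have c := Complex.continuous_conj
  have hT : Tendsto D atTop (nhds (1 * (starRingEnd ℂ) 1 - 0 * (starRingEnd ℂ) 0)) :=
    (tF.mul ((c.tendsto _).comp tF')).sub (tP.mul ((c.tendsto _).comp tP'))
  have hB : Tendsto D atBot (nhds _) :=
    (bF.mul ((c.tendsto _).comp bF')).sub (bP.mul ((c.tendsto _).comp bP'))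
  have hDc : D = fun _ => D 0 := funext hconst
  rw [hDc] at hT hB
  have e1 := tendsto_nhds_unique hT tendsto_const_nhds
  have e2 := tendsto_nhds_unique hB tendsto_const_nhds
  rw [e2, ← e1]; simp

theorem ybd {q : ℝ → ℂ} (hq : Continuous q) (hi : Integrable q) (lam : ℝ) :
    ∃ A : ℝ, 0 ≤ A ∧ Differentiable ℂ (aL1 q lam) ∧ Differentiable ℂ (aL3 q lam) ∧
      (∀ z, ‖aL1 q lam z‖ ≤ Real.exp (A * ‖z‖)) ∧ (∀ z, ‖aL3 q lam z‖ ≤ Real.exp (A * ‖z‖)) ∧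
      aL1 q lam 0 = 1 ∧ (∀ x : ℝ, ‖aL1 q lam x‖ ^ 2 - ‖aL3 q lam x‖ ^ 2 = 1) ∧
      (∀ y : ℝ, ‖aL1 q lam (y * Complex.I)‖ ^ 2 + ‖aL3 q lam (y * Complex.I)‖ ^ 2 = 1) := by
  refine ⟨∫ y, ‖q y‖, int_nn q, ?_, ?_, ?_, ?_, by simp [aL1], ?_, ?_⟩
  · rw [show aL1 q lam = _ from funext (aL1_ser hq hi lam)]
    exact zdiff (int_nn q) (cc_le hq hi lam) inj_even
  · rw [show aL3 q lam = _ from funext (aL3_ser hq hi lam)]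
    exact zdiff (int_nn q) (cc_le hq hi lam) inj_odd
  · intro z; rw [aL1_ser hq hi]; exact zbound (int_nn q) (cc_le hq hi lam) inj_even z
  · intro z; rw [aL3_ser hq hi]; exact zbound (int_nn q) (cc_le hq hi lam) inj_odd z
  · intro x
    have := ydet hq hi lam x
    rw [Complex.conj_ofReal, Complex.mul_conj, Complex.mul_conj, Complex.normSq_eq_norm_sq,
      Complex.normSq_eq_norm_sq] at this
    exact_mod_cast this
  · intro y
    have := ydet hq hi lam (y * Complex.I)
    have e : (starRingEnd ℂ) (y * Complex.I) = -(y * Complex.I) := by simp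
    have e1 : ∀ z, aL1 q lam (-z) = aL1 q lam z := fun z => by
      simp only [aL1_ser hq hi, pow_mul, neg_sq]
    have e3 : ∀ z, aL3 q lam (-z) = -aL3 q lam z := fun z => by
      simp only [aL3_ser hq hi, pow_succ, pow_mul, neg_sq, ← tsum_neg]
      congr 1; funext n; ring
    rw [e, e1, e3, map_neg, mul_neg, sub_neg_eq_add, Complex.mul_conj, Complex.mul_conj,
      Complex.normSq_eq_norm_sq, Complex.normSq_eq_norm_sq] at this
    exact_mod_cast this

theorem stmt9
    (a : ℝ → ℝ) (q : ℝ → ℂ) (a2 : ℝ → ℝ) (q2 : ℝ → ℂ) (lam : ℝ)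
    (ha_cont : Continuous a) (ha_nonneg : ∀ x, 0 ≤ a x) (ha_int : Integrable a)
    (hq_cont : Continuous q) (hq_abs : ∀ x, ‖q x‖ = a x)
    (ha2_cont : Continuous a2) (ha2_nonneg : ∀ x, 0 ≤ a2 x) (ha2_int : Integrable a2)
    (hq2_cont : Continuous q2) (hq2_abs : ∀ x, ‖q2 x‖ = a2 x)
    (d : ℝ) (C₂ : ℝ) (hC₂ : 0 < C₂)
    (α : ℕ → ℝ)
    (hαpos : ∀ l : ℕ, 1 ≤ l → 0 < α l)
    (hαmono : StrictMonoOn α {l : ℕ | 1 ≤ l})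
    (hαle : ∀ l : ℕ, 1 ≤ l → α l ≤ C₂ * l)
    (L : Set ℕ) (hL : L ⊆ {l : ℕ | 1 ≤ l})
    (hLdiv : ¬ Summable fun l : L => (1 : ℝ) / ((l : ℕ) : ℝ))
    (heq : ∀ l ∈ L,
      aL3 q lam ((α l : ℝ) : ℂ) / aL1 q lam ((α l : ℝ) : ℂ) =
        Complex.exp (-(Complex.I * (d : ℂ))) *
          (aL3 q2 lam ((α l : ℝ) : ℂ) / aL1 q2 lam ((α l : ℝ) : ℂ))) :
    ∀ z : ℂ,
      aL1 q lam z = aL1 q2 lam z ∧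
      aL2 q lam z = Complex.exp (Complex.I * (d : ℂ)) * aL2 q2 lam z ∧
      aL3 q lam z = Complex.exp (-(Complex.I * (d : ℂ))) * aL3 q2 lam z ∧
      aL4 q lam z = aL4 q2 lam z := by
  intro z
  have hqi : Integrable q := (ha_int.mono' hq_cont.aestronglyMeasurable
    (Eventually.of_forall fun x => (hq_abs x).le))
  have hq2i : Integrable q2 := (ha2_int.mono' hq2_cont.aestronglyMeasurable
    (Eventually.of_forall fun x => (hq2_abs x).le))
  obtain ⟨A, hA0, dA1, dA3, nA1, nA3, zA, rA, iA⟩ := ybd hq_cont hqi lam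
  obtain ⟨B, hB0, dB1, dB3, nB1, nB3, zB, rB, iB⟩ := ybd hq2_cont hq2i lam
  have detB := ydet hq2_cont hq2i lam
  simp only [aL2_eq, aL4_eq]
  generalize aL1 q lam = a1 at *
  generalize aL3 q lam = a3 at *
  generalize aL1 q2 lam = b1 at *
  generalize aL3 q2 lam = b3 at *
  have hee : (starRingEnd ℂ) (Complex.exp (-(Complex.I * (d : ℂ)))) = Complex.exp (Complex.I * d) := by
    rw [← Complex.exp_conj]; simp
  have he1 : ‖Complex.exp (-(Complex.I * (d : ℂ)))‖ = 1 := by simp [Complex.norm_exp]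
  have he2 : ‖Complex.exp (Complex.I * (d : ℂ))‖ = 1 := by simp [Complex.norm_exp]
  have hmul : Complex.exp (Complex.I * (d : ℂ)) * Complex.exp (-(Complex.I * (d : ℂ))) = 1 := by
    rw [← Complex.exp_add]; simp
  generalize Complex.exp (-(Complex.I * (d : ℂ))) = e at *
  generalize Complex.exp (Complex.I * (d : ℂ)) = e' at *
  have hz : ∀ {x y : ℂ}, ‖x‖ ^ 2 + ‖y‖ ^ 2 = 1 → ‖x‖ ≤ 1 ∧ ‖y‖ ≤ 1 := fun {x y} h =>
    ⟨by nlinarith [norm_nonneg x, sq_nonneg ‖y‖], by nlinarith [norm_nonneg y, sq_nonneg ‖x‖]⟩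
  have hne : ∀ {x y : ℂ}, ‖x‖ ^ 2 - ‖y‖ ^ 2 = 1 → x ≠ 0 := by
    rintro x y h rfl
    simp at h
    nlinarith [sq_nonneg ‖y‖]
  -- the cross difference vanishes
  have hf0 : ∀ z, a3 z * b1 z - e * b3 z * a1 z = 0 := by
    refine xuniq (K := 2) (B := A + B) (M := 2) (m := α 1) ?_ ?_ ?_ (hαpos 1 le_rfl) ?_
    · exact (dA3.mul dB1).sub (((differentiable_const e).mul dB3).mul dA1)
    · intro z
      refine (norm_sub_le _ _).trans ?_
      rw [norm_mul, norm_mul, norm_mul, he1, one_mul, add_mul, Real.exp_add]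
      have := mul_le_mul (nA3 z) (nB1 z) (norm_nonneg _) (Real.exp_nonneg _)
      have := mul_le_mul (nB3 z) (nA1 z) (norm_nonneg _) (Real.exp_nonneg _)
      linarith
    · intro y
      refine (norm_sub_le _ _).trans ?_
      rw [norm_mul, norm_mul, norm_mul, he1, one_mul]
      obtain ⟨h1, h2⟩ := hz (iA y)
      obtain ⟨h3, h4⟩ := hz (iB y)
      have := mul_le_mul h2 h3 (norm_nonneg _) zero_le_one
      have := mul_le_mul h4 h1 (norm_nonneg _) zero_le_one
      linarith
    · intro R
      obtain ⟨T, hT⟩ : ∃ T : Finset L, C₂ * R < ∑ l ∈ T, (1 : ℝ) / ((l : ℕ) : ℝ) := by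
        by_contra hcon
        push Not at hcon
        exact hLdiv (summable_of_sum_le (fun l => by positivity) hcon)
      have hinj : Set.InjOn (fun l : L => α l) T := fun l _ m _ h =>
        Subtype.ext (hαmono.injOn (hL l.2) (hL m.2) h)
      refine ⟨T.image fun l : L => α l, ?_, ?_⟩
      · intro s hs
        obtain ⟨l, _, rfl⟩ := Finset.mem_image.1 hs
        refine ⟨hαmono.monotoneOn (show (1:ℕ) ∈ {l : ℕ | 1 ≤ l} from (le_refl 1 : (1:ℕ) ≤ 1)) (hL l.2) (hL l.2), ?_⟩
        have h := heq l l.2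
        have h1 := hne (rA (α l))
        have h2 := hne (rB (α l))
        field_simp at h
        rw [h]; ring
      · rw [Finset.sum_image hinj]
        have hle : ∑ l ∈ T, (1 : ℝ) / ((l : ℕ) : ℝ) ≤ C₂ * ∑ l ∈ T, 1 / α l := by
          rw [Finset.mul_sum]
          refine Finset.sum_le_sum fun l _ => ?_
          have hl1 : 1 ≤ (l : ℕ) := hL l.2
          have hl : (0 : ℝ) < ((l : ℕ) : ℝ) := by exact_mod_cast hl1
          have hp := hαpos l hl1
          have := hαle l hl1
          rw [mul_one_div, div_le_div_iff₀ hl hp]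
          linarith
        exact le_of_lt (lt_of_mul_lt_mul_left (hT.trans_le hle) hC₂.le)
  set g : ℂ → ℂ := fun z => a1 z * (starRingEnd ℂ) (b1 ((starRingEnd ℂ) z)) -
    e' * a3 z * (starRingEnd ℂ) (b3 ((starRingEnd ℂ) z)) with hg
  have hg1 : ∀ z, g z * b1 z = a1 z := fun z => by
    simp only [hg]
    linear_combination a1 z * detB z - e' * (starRingEnd ℂ) (b3 ((starRingEnd ℂ) z)) * hf0 z -
      a1 z * b3 z * (starRingEnd ℂ) (b3 ((starRingEnd ℂ) z)) * hmul
  have hg3 : ∀ z, g z * (e * b3 z) = a3 z := fun z => by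
    simp only [hg]
    linear_combination a3 z * detB z - (starRingEnd ℂ) (b1 ((starRingEnd ℂ) z)) * hf0 z -
      a3 z * b3 z * (starRingEnd ℂ) (b3 ((starRingEnd ℂ) z)) * hmul
  have hn1 : ∀ z, ‖a1 z‖ ^ 2 = ‖g z‖ ^ 2 * ‖b1 z‖ ^ 2 := fun z => by
    rw [← hg1 z, norm_mul]; ring
  have hn3 : ∀ z, ‖a3 z‖ ^ 2 = ‖g z‖ ^ 2 * ‖b3 z‖ ^ 2 := fun z => by
    rw [← hg3 z, norm_mul, norm_mul, he1]; ring
  have hgle : ∀ z, ‖g z‖ ^ 2 = 1 → ‖g z‖ ≤ 1 := fun z h => by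
    nlinarith [norm_nonneg (g z)]
  have hgc : ∀ z, g z = 1 := by
    intro z
    have h0 : g 0 = 1 := by have := hg1 0; rwa [zA, zB, mul_one] at this
    rw [← h0]
    refine xliou (K := 2) (B := A + B) ?_ ?_ ?_ ?_ z
    · have c1 : Differentiable ℂ (fun z => (starRingEnd ℂ) (b1 ((starRingEnd ℂ) z))) :=
        fun z => differentiableAt_conj_conj_iff.2 (dB1 _) 
      have c3 : Differentiable ℂ (fun z => (starRingEnd ℂ) (b3 ((starRingEnd ℂ) z))) :=
        fun z => differentiableAt_conj_conj_iff.2 (dB3 _)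
      exact (dA1.mul c1).sub (((differentiable_const e').mul dA3).mul c3)
    · intro z
      refine (norm_sub_le _ _).trans ?_
      rw [norm_mul, norm_mul, norm_mul, he2, one_mul, add_mul, Real.exp_add, RCLike.norm_conj,
        RCLike.norm_conj]
      have h1 := nB1 ((starRingEnd ℂ) z)
      have h3 := nB3 ((starRingEnd ℂ) z)
      rw [RCLike.norm_conj] at h1 h3
      have := mul_le_mul (nA1 z) h1 (norm_nonneg _) (Real.exp_nonneg _)
      have := mul_le_mul (nA3 z) h3 (norm_nonneg _) (Real.exp_nonneg _)
      linarith
    · intro x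
      refine hgle _ ?_
      have := rA x
      rw [hn1, hn3, ← mul_sub, rB, mul_one] at this
      exact this
    · intro y
      refine hgle _ ?_
      have := iA y
      rw [hn1, hn3, ← mul_add, iB, mul_one] at this
      exact this
  have E1 : ∀ z, a1 z = b1 z := fun z => by rw [← hg1, hgc, one_mul]
  have E3 : ∀ z, a3 z = e * b3 z := fun z => by rw [← hg3, hgc, one_mul]
  refine ⟨E1 z, ?_, E3 z, ?_⟩
  · rw [E3, map_mul, hee]
  · rw [E1]
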